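/- Let a > 1 and x > 0. Then ∫_{−x}^{ax} ∫_{−x}^{ax} φ(u)·φ(v)·2(u+v)(u−v)² du dv > 0. -/

import Mathlib

open MeasureTheory intervalIntegral

/-- `φ(x) = exp(-x²)`. -/
noncomputable def phi (x : ℝ) : ℝ := Real.exp (-x ^ 2)

theorem phi_pos (u : ℝ) : 0 < phi u := Real.exp_pos _

theorem phi_neg (u : ℝ) : phi (-u) = phi u := by simp [phi]

theorem continuous_phi : Continuous phi := by
  unfold phi
  fun_prop

/-- The `k`-th moment of `phi` over the interval from `p` to `q`. -/
noncomputable def phiMoment (k : ℕ) (p q : ℝ) : ℝ := ∫ u in p..q, u ^ k * phi u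

theorem intervalIntegrable_pow_mul_phi (k : ℕ) (p q : ℝ) :
    IntervalIntegrable (fun u => u ^ k * phi u) volume p q :=
  ((continuous_pow k).mul continuous_phi).intervalIntegrable p q

theorem phiMoment_add (k : ℕ) (p q r : ℝ) :
    phiMoment k p q + phiMoment k q r = phiMoment k p r :=
  integral_add_adjacent_intervals (intervalIntegrable_pow_mul_phi k p q)
    (intervalIntegrable_pow_mul_phi k q r)

theorem phiMoment_symm_of_odd {k : ℕ} (hk : Odd k) (x : ℝ) : phiMoment k (-x) x = 0 := by
  have h := integral_comp_neg (a := -x) (b := x) (fun u => u ^ k * phi u)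
  simp only [hk.neg_pow, phi_neg, neg_mul, intervalIntegral.integral_neg, neg_neg] at h
  unfold phiMoment
  linarith

theorem integral_cubic_mul_phi (c₀ c₁ c₂ c₃ p q : ℝ) :
    ∫ u in p..q, (c₀ * (u ^ 0 * phi u) + c₁ * (u ^ 1 * phi u) + c₂ * (u ^ 2 * phi u)
        + c₃ * (u ^ 3 * phi u))
      = c₀ * phiMoment 0 p q + c₁ * phiMoment 1 p q + c₂ * phiMoment 2 p q
        + c₃ * phiMoment 3 p q := by
  have h (k : ℕ) (c : ℝ) := (intervalIntegrable_pow_mul_phi k p q).const_mul c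
  rw [integral_add (((h 0 c₀).add (h 1 c₁)).add (h 2 c₂)) (h 3 c₃),
    integral_add ((h 0 c₀).add (h 1 c₁)) (h 2 c₂), integral_add (h 0 c₀) (h 1 c₁)]
  simp only [intervalIntegral.integral_const_mul, phiMoment]

theorem integral_integral_phi_mul_phi (p q : ℝ) :
    ∫ v in p..q, ∫ u in p..q, phi u * phi v * (2 * (u + v) * (u - v) ^ 2)
      = 4 * (phiMoment 3 p q * phiMoment 0 p q - phiMoment 2 p q * phiMoment 1 p q) := by
  have inner (v : ℝ) : ∫ u in p..q, phi u * phi v * (2 * (u + v) * (u - v) ^ 2)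
      = (2 * phiMoment 3 p q) * (v ^ 0 * phi v) + (-2 * phiMoment 2 p q) * (v ^ 1 * phi v)
        + (-2 * phiMoment 1 p q) * (v ^ 2 * phi v) + (2 * phiMoment 0 p q) * (v ^ 3 * phi v) := by
    have e : (fun u => phi u * phi v * (2 * (u + v) * (u - v) ^ 2)) = fun u =>
        2 * v ^ 3 * phi v * (u ^ 0 * phi u) + -2 * v ^ 2 * phi v * (u ^ 1 * phi u)
          + -2 * v * phi v * (u ^ 2 * phi u) + 2 * phi v * (u ^ 3 * phi u) := by
      funext u
      ring
    rw [e, integral_cubic_mul_phi]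
    ring
  simp only [inner]
  rw [integral_cubic_mul_phi]
  ring

theorem statement_11 (a x : ℝ) (ha : 1 < a) (hx : 0 < x) :
    0 < ∫ v in (-x)..(a * x), ∫ u in (-x)..(a * x),
        phi u * phi v * (2 * (u + v) * (u - v) ^ 2) := by
  have hxy : x < a * x := by nlinarith
  generalize a * x = y at hxy ⊢
  have tail_kernel : 0 ≤ phiMoment 3 x y * phiMoment 0 x y - phiMoment 2 x y * phiMoment 1 x y := by
    have h : 0 ≤ ∫ v in x..y, ∫ u in x..y, phi u * phi v * (2 * (u + v) * (u - v) ^ 2) := by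
      refine integral_nonneg hxy.le fun v hv => integral_nonneg hxy.le fun u hu => ?_
      have hu' : 0 < u := hx.trans_le hu.1
      have hv' : 0 < v := hx.trans_le hv.1
      have := phi_pos u
      have := phi_pos v
      positivity
    rw [integral_integral_phi_mul_phi] at h
    linarith
  have center_zero : 0 < phiMoment 0 (-x) x :=
    intervalIntegral_pos_of_pos_on (intervalIntegrable_pow_mul_phi 0 _ _)
      (fun u _ => by simpa using phi_pos u) (by linarith)
  have tail_one : 0 < phiMoment 1 x y :=
    intervalIntegral_pos_of_pos_on (intervalIntegrable_pow_mul_phi 1 _ _)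
      (fun u hu => mul_pos (pow_pos (hx.trans hu.1) 1) (phi_pos u)) hxy
  have center_two : phiMoment 2 (-x) x ≤ x ^ 2 * phiMoment 0 (-x) x := by
    unfold phiMoment
    rw [← intervalIntegral.integral_const_mul]
    refine integral_mono_on (by linarith) (intervalIntegrable_pow_mul_phi 2 _ _)
      ((intervalIntegrable_pow_mul_phi 0 _ _).const_mul _) fun u hu => ?_
    have : u ^ 2 ≤ x ^ 2 := sq_le_sq' hu.1 hu.2
    nlinarith [phi_pos u]
  have tail_three : x ^ 2 * phiMoment 1 x y < phiMoment 3 x y := by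
    have h : 0 < ∫ u in x..y, (u ^ 3 * phi u - x ^ 2 * (u ^ 1 * phi u)) := by
      refine intervalIntegral_pos_of_pos_on ((intervalIntegrable_pow_mul_phi 3 _ _).sub
        ((intervalIntegrable_pow_mul_phi 1 _ _).const_mul _)) (fun u hu => ?_) hxy
      have hu' : 0 < u := hx.trans hu.1
      have h2 : 0 < u ^ 2 - x ^ 2 := by nlinarith [hu.1]
      have := mul_pos (mul_pos hu' h2) (phi_pos u)
      linarith
    rw [integral_sub (intervalIntegrable_pow_mul_phi 3 _ _)
      ((intervalIntegrable_pow_mul_phi 1 _ _).const_mul _),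
      intervalIntegral.integral_const_mul] at h
    exact sub_pos.mp h
  rw [integral_integral_phi_mul_phi]
  simp only [← phiMoment_add _ (-x) x y, phiMoment_symm_of_odd (k := 1) (by decide) x,
    phiMoment_symm_of_odd (k := 3) (by decide) x]
  nlinarith [mul_pos (sub_pos.mpr tail_three) center_zero,
    mul_nonneg (sub_nonneg.mpr center_two) tail_one.le]
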